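/- Suppose ∑_{n=1}^{∞} b_n = ∞. Let T(ω) = inf{n ≥ 1 : ω_n = 0} be the first return time to 0 (an ℕ∪{∞}-valued function on ℕ^ℕ). Then the mean return time to 0 is finite, i.e. ∫ T dμ_0 < ∞, if and only if the series ∑_{n=1}^{∞} a_n converges, where a_n = ∏_{i=1}^{n} (p_{i−1}/q_i). (That is, the chain is positive recurrent if and only if ∑ a_n < ∞, and null recurrent if and only if ∑ a_n = ∞.) -/

import Mathlib

open MeasureTheory
open scoped ENNReal

/-- Transition probabilities of the reflecting birth-death chain on `ℕ`:
from `0` move to `1` with probability `1`; for `i ≥ 1`, move to `i+1` with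
probability `p i` and to `i-1` with probability `q i`. -/
noncomputable def rfKernel (p q : ℕ → ℝ) : ℕ → ℕ → ℝ := fun i j =>
  if i = 0 then (if j = 1 then 1 else 0)
  else if j = i + 1 then p i else if j = i - 1 then q i else 0

/-- `μ i` is the law (on path space, obtained via Ionescu–Tulcea) of the reflecting
birth-death chain started at `i`, characterised by its finite-dimensional (cylinder)
distributions. -/
def IsRFLaw (p q : ℕ → ℝ) (μ : ℕ → Measure (ℕ → ℕ)) : Prop :=
  ∀ (i n : ℕ) (f : ℕ → ℕ),
    μ i {ω : ℕ → ℕ | ∀ m ≤ n, ω m = f m} =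
      ENNReal.ofReal ((if f 0 = i then (1 : ℝ) else 0) *
        ∏ m ∈ Finset.range n, rfKernel p q (f m) (f (m + 1)))

/-- `bseq p q n = ∏_{i=1}^{n} q_i / p_i` (so `bseq p q 0 = 1`). -/
noncomputable def bseq (p q : ℕ → ℝ) (n : ℕ) : ℝ :=
  ∏ i ∈ Finset.Icc 1 n, q i / p i

/-- `aseq p q n = ∏_{i=1}^{n} p_{i-1} / q_i`. -/
noncomputable def aseq (p q : ℕ → ℝ) (n : ℕ) : ℝ :=
  ∏ i ∈ Finset.Icc 1 n, p (i - 1) / q i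

namespace ReflectingChain

/-- The paths which do not visit `0` at the times `1, …, n`. -/
def noReturn (n : ℕ) : Set (ℕ → ℕ) := {ω | ∀ m, 1 ≤ m → m ≤ n → ω m ≠ 0}

lemma measurableSet_eval_eq (n j : ℕ) : MeasurableSet {ω : ℕ → ℕ | ω n = j} :=
  (measurableSet_singleton j).preimage (measurable_pi_apply n)

lemma measurableSet_noReturn (n : ℕ) : MeasurableSet (noReturn n) := by
  have : noReturn n = ⋂ m, ⋂ (_ : 1 ≤ m), ⋂ (_ : m ≤ n), {ω : ℕ → ℕ | ω m = 0}ᶜ := by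
    ext ω; simp [noReturn]
  rw [this]
  exact .iInter fun m => .iInter fun _ => .iInter fun _ => (measurableSet_eval_eq m 0).compl

lemma iInf_mem_eq_tsum (M : Set ℕ) :
    (⨅ n ∈ M, (n : ℝ≥0∞)) = ∑' n : ℕ, Set.indicator {n | ∀ m ∈ M, n < m} (fun _ => 1) n := by
  classical
  rcases M.eq_empty_or_nonempty with rfl | hM
  · simp
  · have hmem := Nat.sInf_mem hM
    have hset : {n | ∀ m ∈ M, n < m} = ↑(Finset.range (sInf M)) := by
      ext n
      simp only [Set.mem_ofPred_eq, Finset.coe_range, Set.mem_Iio]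
      exact ⟨fun h => h _ hmem, fun h m hm => h.trans_le (Nat.sInf_le hm)⟩
    rw [hset, ← sum_eq_tsum_indicator]
    simp only [Finset.sum_const, Finset.card_range, nsmul_eq_mul, mul_one]
    exact le_antisymm (iInf₂_le _ hmem)
      (le_iInf₂ fun m hm => Nat.cast_le.mpr (Nat.sInf_le hm))

lemma lintegral_return_time (ν : Measure (ℕ → ℕ)) :
    ∫⁻ ω, (⨅ n ∈ {m : ℕ | 1 ≤ m ∧ ω m = 0}, (n : ℝ≥0∞)) ∂ν = ∑' n, ν (noReturn n) := by
  have h : ∀ ω : ℕ → ℕ, (⨅ n ∈ {m : ℕ | 1 ≤ m ∧ ω m = 0}, (n : ℝ≥0∞)) =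
      ∑' n, (noReturn n).indicator (fun _ => 1) ω := by
    intro ω
    rw [iInf_mem_eq_tsum]
    refine tsum_congr fun n => ?_
    have : n ∈ {n | ∀ m ∈ {m : ℕ | 1 ≤ m ∧ ω m = 0}, n < m} ↔ ω ∈ noReturn n := by
      simp only [noReturn, Set.mem_ofPred_eq]
      exact ⟨fun h m h1 h2 h0 => absurd (h m ⟨h1, h0⟩) (by lia),
        fun h m hm => by by_contra hlt; exact h m hm.1 (by lia) hm.2⟩
    by_cases hω : ω ∈ noReturn n
    · rw [Set.indicator_of_mem hω, Set.indicator_of_mem (this.mpr hω)]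
    · rw [Set.indicator_of_notMem hω, Set.indicator_of_notMem (mt this.mp hω)]
  simp_rw [h]
  rw [lintegral_tsum fun n => (measurable_const.indicator (measurableSet_noReturn n)).aemeasurable]
  exact tsum_congr fun n => by
    rw [lintegral_indicator (measurableSet_noReturn n)]; simp

lemma measure_eq_tsum_fiber {α β : Type*} [MeasurableSpace α] [MeasurableSpace β] [Countable β]
    [MeasurableSingletonClass β] (ν : Measure α) {r : α → β} (hr : Measurable r) {S : Set α}
    (hS : MeasurableSet S) : ν S = ∑' f, ν (S ∩ r ⁻¹' {f}) := by
  rw [← measure_iUnion, ← Set.inter_iUnion, ← Set.preimage_iUnion]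
  · rw [Set.iUnion_of_singleton, Set.preimage_univ, Set.inter_univ]
  · exact fun f g hfg => ((Set.disjoint_singleton.mpr hfg).preimage r).mono
      Set.inter_subset_right Set.inter_subset_right
  · exact fun f => hS.inter (hr (measurableSet_singleton f))

lemma measure_eq_tsum_eval (ν : Measure (ℕ → ℕ)) (n : ℕ) {S : Set (ℕ → ℕ)}
    (hS : MeasurableSet S) : ν S = ∑' j, ν (S ∩ {ω | ω n = j}) :=
  measure_eq_tsum_fiber ν (measurable_pi_apply n) hS

lemma rfKernel_nonneg {p q : ℕ → ℝ} (hp : ∀ i, 1 ≤ i → 0 ≤ p i) (hq : ∀ i, 1 ≤ i → 0 ≤ q i)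
    (i j : ℕ) : 0 ≤ rfKernel p q i j := by
  have := hp i
  have := hq i
  unfold rfKernel
  split_ifs <;> first | positivity | grind

/-- The Markov property at time `n`, for events determined by the first `n + 1` coordinates. -/
lemma measure_inter_step {p q : ℕ → ℝ} (hp : ∀ i, 1 ≤ i → 0 ≤ p i) (hq : ∀ i, 1 ≤ i → 0 ≤ q i)
    {μ : ℕ → Measure (ℕ → ℕ)} (hlaw : IsRFLaw p q μ) (a n i j : ℕ) {S : Set (ℕ → ℕ)}
    (hS : MeasurableSet S) (hdep : ∀ ω ω' : ℕ → ℕ, (∀ m ≤ n, ω m = ω' m) → ω ∈ S → ω' ∈ S) :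
    μ a ((S ∩ {ω | ω n = i}) ∩ {ω | ω (n + 1) = j}) =
      μ a (S ∩ {ω | ω n = i}) * ENNReal.ofReal (rfKernel p q i j) := by
  let r : (ℕ → ℕ) → (Fin (n + 1) → ℕ) := fun ω k => ω k
  have hr : Measurable r := measurable_pi_lambda _ fun k => measurable_pi_apply _
  have hSi : MeasurableSet (S ∩ {ω | ω n = i}) := hS.inter (measurableSet_eval_eq n i)
  rw [measure_eq_tsum_fiber _ hr (hSi.inter (measurableSet_eval_eq _ j)),
    measure_eq_tsum_fiber _ hr hSi, ← ENNReal.tsum_mul_right]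
  refine tsum_congr fun f => ?_
  let g : ℕ → ℕ := fun m => if h : m < n + 1 then f ⟨m, h⟩ else j
  have hrg : ∀ ω, r ω = f ↔ ∀ m ≤ n, ω m = g m := by
    intro ω
    constructor
    · rintro rfl m hm
      simp only [g, dif_pos (Nat.lt_succ_of_le hm), r]
    · intro h
      funext k
      exact (h k (Nat.le_of_lt_succ k.2)).trans (dif_pos k.2)
  have hg : g (n + 1) = j := by simp [g]
  by_cases hmem : g ∈ S ∩ {ω | ω n = i}
  · have hin : ∀ ω, (∀ m ≤ n, ω m = g m) → ω ∈ S ∩ {ω | ω n = i} := fun ω h =>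
      ⟨hdep g ω (fun m hm => (h m hm).symm) hmem.1, (h n le_rfl).trans hmem.2⟩
    have h1 : (S ∩ {ω | ω n = i}) ∩ r ⁻¹' {f} = {ω | ∀ m ≤ n, ω m = g m} := by
      ext ω
      simp only [Set.mem_inter_iff, Set.mem_preimage, Set.mem_singleton_iff, hrg]
      exact ⟨fun h => h.2, fun h => ⟨hin ω h, h⟩⟩
    have h2 : ((S ∩ {ω | ω n = i}) ∩ {ω | ω (n + 1) = j}) ∩ r ⁻¹' {f} =
        {ω | ∀ m ≤ n + 1, ω m = g m} := by
      rw [Set.inter_right_comm, h1]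
      ext ω
      simp only [Set.mem_inter_iff, Set.mem_ofPred_eq]
      constructor
      · rintro ⟨h, h'⟩ m hm
        rcases Nat.le_succ_iff.mp hm with hm | rfl
        · exact h m hm
        · rw [h', hg]
      · exact fun h => ⟨fun m hm => h m (by lia), (h _ le_rfl).trans hg⟩
    rw [h1, h2, hlaw, hlaw, Finset.prod_range_succ, ← mul_assoc, hg, hmem.2, ENNReal.ofReal_mul]
    have := Finset.prod_nonneg (s := Finset.range n)
      fun m _ => rfKernel_nonneg hp hq (g m) (g (m + 1))
    split_ifs <;> simp [this]
  · have hout : (S ∩ {ω | ω n = i}) ∩ r ⁻¹' {f} = ∅ := by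
      rw [Set.eq_empty_iff_forall_notMem]
      rintro ω ⟨hω, h⟩
      have h := (hrg ω).mp h
      exact hmem ⟨hdep ω g h hω.1, (h n le_rfl).symm.trans hω.2⟩
    rw [Set.inter_right_comm, hout]
    simp

/-- The probability of being at `j` at time `n` without a return to `0` in between. -/
noncomputable def taboo (ν : Measure (ℕ → ℕ)) (n j : ℕ) : ℝ≥0∞ :=
  ν (noReturn n ∩ {ω | ω n = j})

lemma noReturn_congr {n : ℕ} {ω ω' : ℕ → ℕ} (h : ∀ m ≤ n, ω m = ω' m) (hω : ω ∈ noReturn n) :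
    ω' ∈ noReturn n := fun m h1 h2 => h m h2 ▸ hω m h1 h2

lemma taboo_zero {p q : ℕ → ℝ} {μ : ℕ → Measure (ℕ → ℕ)}
    (hlaw : IsRFLaw p q μ) (j : ℕ) : taboo (μ 0) 0 j = if j = 0 then 1 else 0 := by
  have h := hlaw 0 0 (fun _ => j)
  have hset : noReturn 0 ∩ {ω | ω 0 = j} = {ω : ℕ → ℕ | ∀ m ≤ 0, ω m = j} := by
    ext ω; simp [noReturn]; lia
  rw [taboo, hset, h]
  split_ifs <;> simp

lemma taboo_succ_zero (ν : Measure (ℕ → ℕ)) (n : ℕ) : taboo ν (n + 1) 0 = 0 := by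
  have : noReturn (n + 1) ∩ {ω | ω (n + 1) = 0} = ∅ := by
    rw [Set.eq_empty_iff_forall_notMem]
    exact fun ω hω => hω.1 (n + 1) (by lia) le_rfl hω.2
  rw [taboo, this, measure_empty]

lemma taboo_succ_succ {p q : ℕ → ℝ} (hp : ∀ i, 1 ≤ i → 0 ≤ p i)
    (hq : ∀ i, 1 ≤ i → 0 ≤ q i) (hp0 : p 0 = 1) {μ : ℕ → Measure (ℕ → ℕ)}
    (hlaw : IsRFLaw p q μ) (n j : ℕ) : taboo (μ 0) (n + 1) (j + 1) =
    taboo (μ 0) n j * ENNReal.ofReal (p j) +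
      taboo (μ 0) n (j + 2) * ENNReal.ofReal (q (j + 2)) := by
  have hset : noReturn (n + 1) ∩ {ω | ω (n + 1) = j + 1} =
      noReturn n ∩ {ω | ω (n + 1) = j + 1} := by
    ext ω
    simp only [noReturn, Set.mem_inter_iff, Set.mem_ofPred_eq]
    constructor
    · exact fun h => ⟨fun m h1 h2 => h.1 m h1 (by lia), h.2⟩
    · rintro ⟨h, h'⟩
      refine ⟨fun m h1 h2 => ?_, h'⟩
      rcases Nat.le_succ_iff.mp h2 with h2 | rfl
      · exact h m h1 h2
      · rw [h']; lia
  have hstep : ∀ i, μ 0 ((noReturn n ∩ {ω | ω (n + 1) = j + 1}) ∩ {ω | ω n = i}) =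
      taboo (μ 0) n i * ENNReal.ofReal (rfKernel p q i (j + 1)) := fun i => by
    rw [Set.inter_right_comm, measure_inter_step hp hq hlaw 0 n i (j + 1)
      (measurableSet_noReturn n) (fun _ _ => noReturn_congr), taboo]
  rw [taboo, hset, measure_eq_tsum_eval _ n
    ((measurableSet_noReturn n).inter (measurableSet_eval_eq _ _)), tsum_congr hstep,
    tsum_eq_sum (s := {j, j + 2}), Finset.sum_pair (by lia)]
  · congr 3
    · unfold rfKernel
      rcases j with _ | j <;> simp [hp0]
    · simp [rfKernel]
  · intro i hi
    simp only [Finset.mem_insert, Finset.mem_singleton, not_or] at hi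
    have : rfKernel p q i (j + 1) = 0 := by
      unfold rfKernel
      split_ifs <;> first | rfl | lia
    simp [this]

lemma tsum_taboo_one_mul_le_one {p q : ℕ → ℝ} (hp : ∀ i, 1 ≤ i → 0 ≤ p i)
    (hq : ∀ i, 1 ≤ i → 0 ≤ q i) {μ : ℕ → Measure (ℕ → ℕ)}
    (hlaw : IsRFLaw p q μ) [IsProbabilityMeasure (μ 0)] :
    (∑' n, taboo (μ 0) n 1) * ENNReal.ofReal (q 1) ≤ 1 := by
  have hker : rfKernel p q 1 0 = q 1 := by simp [rfKernel]
  have hstep : ∀ n, taboo (μ 0) n 1 * ENNReal.ofReal (q 1) =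
      μ 0 ((noReturn n ∩ {ω | ω n = 1}) ∩ {ω | ω (n + 1) = 0}) := fun n => by
    rw [measure_inter_step hp hq hlaw 0 n 1 0 (measurableSet_noReturn n)
      (fun _ _ => noReturn_congr), taboo, hker]
  rw [← ENNReal.tsum_mul_right, tsum_congr hstep, ← measure_iUnion]
  · exact prob_le_one
  · have key : ∀ m n, m < n → Disjoint
        ((noReturn m ∩ {ω | ω m = 1}) ∩ {ω | ω (m + 1) = 0})
        ((noReturn n ∩ {ω | ω n = 1}) ∩ {ω | ω (n + 1) = 0}) := fun m n hmn =>
      Set.disjoint_left.mpr fun ω hm hn => hn.1.1 (m + 1) (by lia) hmn hm.2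
    intro m n hmn
    rcases lt_or_gt_of_ne hmn with h | h
    · exact key m n h
    · exact (key n m h).symm
  · exact fun n => ((measurableSet_noReturn n).inter (measurableSet_eval_eq _ _)).inter
      (measurableSet_eval_eq _ _)

lemma tsum_taboo_zero {p q : ℕ → ℝ} {μ : ℕ → Measure (ℕ → ℕ)}
    (hlaw : IsRFLaw p q μ) : ∑' n, taboo (μ 0) n 0 = 1 := by
  rw [tsum_eq_zero_add' ENNReal.summable, taboo_zero hlaw]
  simp [taboo_succ_zero]

lemma tsum_taboo_succ {p q : ℕ → ℝ} (hp : ∀ i, 1 ≤ i → 0 ≤ p i)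
    (hq : ∀ i, 1 ≤ i → 0 ≤ q i) (hp0 : p 0 = 1) {μ : ℕ → Measure (ℕ → ℕ)}
    (hlaw : IsRFLaw p q μ) (j : ℕ) : ∑' n, taboo (μ 0) n (j + 1) =
    (∑' n, taboo (μ 0) n j) * ENNReal.ofReal (p j) +
      (∑' n, taboo (μ 0) n (j + 2)) * ENNReal.ofReal (q (j + 2)) := by
  rw [tsum_eq_zero_add' ENNReal.summable, taboo_zero hlaw,
    tsum_congr fun n => taboo_succ_succ hp hq hp0 hlaw n j, ENNReal.tsum_add,
    ENNReal.tsum_mul_right, ENNReal.tsum_mul_right]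
  simp

lemma aseq_succ (p q : ℕ → ℝ) (n : ℕ) :
    aseq p q (n + 1) = aseq p q n * (p n / q (n + 1)) := by
  rw [aseq, aseq, Finset.prod_Icc_succ_top (by lia), Nat.add_sub_cancel]

lemma bseq_succ (p q : ℕ → ℝ) (n : ℕ) :
    bseq p q (n + 1) = bseq p q n * (q (n + 1) / p (n + 1)) := by
  rw [bseq, bseq, Finset.prod_Icc_succ_top (by lia)]

/-- A nonnegative solution of the taboo equations with nonnegative flux equals `aseq`, provided
that `bseq` is not summable. -/
lemma eq_aseq_of_harmonic {p q g : ℕ → ℝ} (hp : ∀ i, 0 < p i) (hq : ∀ i, 1 ≤ i → 0 < q i)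
    (hpq : ∀ i, 1 ≤ i → p i + q i = 1) (hp0 : p 0 = 1)
    (hb : ¬ Summable fun n => bseq p q (n + 1)) (hg : ∀ j, 0 ≤ g j) (hg0 : g 0 = 1)
    (hg1 : g 1 * q 1 ≤ 1) (hrec : ∀ j, g (j + 1) = g j * p j + g (j + 2) * q (j + 2)) (j : ℕ) :
    g j = aseq p q j := by
  set F := 1 - g 1 * q 1 with hF
  have hflux : ∀ j, g j * p j - g (j + 1) * q (j + 1) = F := by
    intro j
    induction j with
    | zero => rw [hg0, hp0, hF]; ring
    | succ j ih =>
      have h1 := hrec j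
      have h2 := hpq (j + 1) (by lia)
      have h3 : p (j + 1) = 1 - q (j + 1) := by linarith
      rw [h3]
      show g (j + 1) * (1 - q (j + 1)) - g (j + 2) * q (j + 2) = F
      linarith
  have hapos : ∀ j, 0 < aseq p q j := fun j =>
    Finset.prod_pos fun i hi => div_pos (hp _) (hq i (Finset.mem_Icc.mp hi).1)
  have hbpos : ∀ j, 0 < bseq p q j := fun j =>
    Finset.prod_pos fun i hi => div_pos (hq i (Finset.mem_Icc.mp hi).1) (hp _)
  have hab : ∀ j, aseq p q j * p j * bseq p q j = 1 := by
    intro j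
    induction j with
    | zero => simp [aseq, bseq, hp0]
    | succ j ih =>
      have := (hp (j + 1)).ne'
      have := (hq (j + 1) (by lia)).ne'
      rw [aseq_succ, bseq_succ, ← ih]
      field_simp
  have hsol : ∀ j, g j = aseq p q j * (1 - F * ∑ i ∈ Finset.range j, bseq p q i) := by
    intro j
    induction j with
    | zero => simp [hg0, aseq]
    | succ j ih =>
      have h1 := hflux j
      have h2 := hab j
      have hqj := (hq (j + 1) (by lia)).ne'
      have h3 : g (j + 1) = (g j * p j - F) / q (j + 1) := by
        rw [eq_div_iff hqj]; linarith
      rw [h3, ih, aseq_succ, Finset.sum_range_succ]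
      field_simp
      linear_combination F * h2
  have hF0 : F = 0 := by
    by_contra hne
    have hFpos : 0 < F := lt_of_le_of_ne (by linarith) (Ne.symm hne)
    refine hb ((summable_nat_add_iff 1).mpr
      (summable_of_sum_range_le (c := 1 / F) (fun n => (hbpos n).le) fun n => ?_))
    rw [le_div_iff₀ hFpos]
    have := nonneg_of_mul_nonneg_right (hsol n ▸ hg n) (hapos n)
    linarith
  simpa [hF0] using hsol j

end ReflectingChain

open ReflectingChain in
theorem stmt8 (p q : ℕ → ℝ)
    (hp : ∀ i, 1 ≤ i → p i ∈ Set.Ioo (0 : ℝ) 1) (hq : ∀ i, 1 ≤ i → q i ∈ Set.Ioo (0 : ℝ) 1)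
    (hpq : ∀ i, 1 ≤ i → p i + q i = 1) (hp0 : p 0 = 1)
    (μ : ℕ → Measure (ℕ → ℕ)) (hμ : ∀ i, IsProbabilityMeasure (μ i))
    (hlaw : IsRFLaw p q μ)
    (hb : ¬ Summable (fun n : ℕ => bseq p q (n + 1))) :
    ((∫⁻ ω, (⨅ n ∈ {m : ℕ | 1 ≤ m ∧ ω m = 0}, (n : ℝ≥0∞)) ∂(μ 0)) < ⊤ ↔
      Summable (fun n : ℕ => aseq p q (n + 1))) := by
  have hp' : ∀ i, 0 < p i := fun i => by
    rcases i with _ | i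
    · simp [hp0]
    · exact (hp _ (by lia)).1
  have hq' : ∀ i, 1 ≤ i → 0 < q i := fun i hi => (hq i hi).1
  have hpn : ∀ i, 1 ≤ i → 0 ≤ p i := fun i _ => (hp' i).le
  have hqn : ∀ i, 1 ≤ i → 0 ≤ q i := fun i hi => (hq' i hi).le
  let G : ℕ → ℝ≥0∞ := fun j => ∑' n, taboo (μ 0) n j
  have hG0 : G 0 = 1 := tsum_taboo_zero hlaw
  have hG1 : G 1 * ENNReal.ofReal (q 1) ≤ 1 := tsum_taboo_one_mul_le_one hpn hqn hlaw
  have hrec : ∀ j, G (j + 1) =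
      G j * ENNReal.ofReal (p j) + G (j + 2) * ENNReal.ofReal (q (j + 2)) :=
    tsum_taboo_succ hpn hqn hp0 hlaw
  have hfin_of_mul : ∀ j, G (j + 1) * ENNReal.ofReal (q (j + 1)) ≠ ⊤ → G (j + 1) ≠ ⊤ := by
    intro j h htop
    refine h ?_
    rw [htop, ENNReal.top_mul]
    simpa using hq' (j + 1) (by lia)
  have hfin : ∀ j, G j ≠ ⊤ := by
    intro j
    induction j using Nat.twoStepInduction with
    | zero => simp [hG0]
    | one => exact hfin_of_mul 0 (hG1.trans_lt ENNReal.one_lt_top).ne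
    | more j _ ih =>
      refine hfin_of_mul (j + 1) (ne_top_of_le_ne_top ih ?_)
      rw [hrec j]
      exact le_add_self
  have hG : ∀ j, (G j).toReal = aseq p q j := by
    refine eq_aseq_of_harmonic hp' hq' hpq hp0 hb (fun j => ENNReal.toReal_nonneg)
      (by simp [hG0]) ?_ fun j => ?_
    · have := ENNReal.toReal_mono ENNReal.one_ne_top hG1
      rwa [ENNReal.toReal_mul, ENNReal.toReal_ofReal (hqn 1 le_rfl), ENNReal.toReal_one] at this
    · rw [hrec j, ENNReal.toReal_add (ENNReal.mul_ne_top (hfin j) ENNReal.ofReal_ne_top)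
        (ENNReal.mul_ne_top (hfin (j + 2)) ENNReal.ofReal_ne_top), ENNReal.toReal_mul,
        ENNReal.toReal_mul, ENNReal.toReal_ofReal (hp' j).le,
        ENNReal.toReal_ofReal (hqn (j + 2) (by lia))]
  have hmean : ∫⁻ ω, (⨅ n ∈ {m : ℕ | 1 ≤ m ∧ ω m = 0}, (n : ℝ≥0∞)) ∂(μ 0) = ∑' j, G j := by
    rw [lintegral_return_time,
      tsum_congr fun n => measure_eq_tsum_eval (μ 0) n (measurableSet_noReturn n),
      ENNReal.tsum_comm]
    rfl
  rw [hmean, summable_nat_add_iff 1, ← funext hG, lt_top_iff_ne_top]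
  refine ⟨ENNReal.summable_toReal, fun h => ?_⟩
  rw [← tsum_congr fun j => ENNReal.ofReal_toReal (hfin j)]
  exact h.tsum_ofReal_ne_top
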